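/- Let α > 0 and let v : ℝ → ℝ be a symmetrically decreasing function satisfying 0 ≤ v ≤ min(2α,1), ∫_ℝ v(z) dz = 2α, and |v(z+ρ) − v(z)| ≤ ρ for all z ∈ ℝ and ρ > 0. Let v_0 = 1_{(−α,α)} ∗ M_1, that is, v_0 is the symmetrically decreasing function equal to min(2α,1) on [0, |α−1/2|], affine with slope −1 on (|α−1/2|, α+1/2), and equal to 0 on [α+1/2, ∞). Then for every t_0 > 0, ∫_{−t_0}^{t_0} v(z) dz ≤ ∫_{−t_0}^{t_0} v_0(z) dz. -/

import Mathlib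

open MeasureTheory Set

/-- Convolution of real-valued functions on `ℝ`. -/
noncomputable def convR (f g : ℝ → ℝ) (x : ℝ) : ℝ := ∫ y, f (x - y) * g y

/-- A function `f : ℝ → ℝ` is symmetrically decreasing if `f(-x) = f(x)` for all `x`
and `f(y) ≤ f(x)` whenever `0 < x < y`. -/
def SymmDecrR (f : ℝ → ℝ) : Prop :=
  (∀ x : ℝ, f (-x) = f x) ∧ ∀ x y : ℝ, 0 < x → x < y → f y ≤ f x

/-- `M₁ = 1_{(−1/2, 1/2)}`. -/
noncomputable def M1 : ℝ → ℝ := (Set.Ioo (-(1:ℝ)/2) (1/2)).indicator (fun _ => (1:ℝ))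

/-- Closed form of `1_{(−α, α)} ∗ M₁`. -/
theorem convR_indicator_M1 (α z : ℝ) :
    convR ((Ioo (-α) α).indicator (fun _ => (1:ℝ))) M1 z
      = max 0 (min (min (2 * α) 1) (α + 1 / 2 - |z|)) := by
  have h : (fun y => (Ioo (-α) α).indicator (fun _ => (1:ℝ)) (z - y) * M1 y)
      = (Ioo (max (z - α) (-1 / 2)) (min (z + α) (1 / 2))).indicator (fun _ => (1:ℝ)) := by
    funext y
    have hy : (z - y ∈ Ioo (-α) α) ↔ y ∈ Ioo (z - α) (z + α) := by
      constructor <;> rintro ⟨h₁, h₂⟩ <;> constructor <;> linarith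
    simp only [M1, indicator_apply, hy, ← Ioo_inter_Ioo, mem_inter_iff]
    by_cases h₁ : y ∈ Ioo (z - α) (z + α) <;>
      by_cases h₂ : y ∈ Ioo (-(1:ℝ) / 2) (1 / 2) <;> simp [h₁]
  rw [convR, h, integral_indicator measurableSet_Ioo]
  simp only [integral_const, smul_eq_mul, mul_one, measureReal_restrict_apply_univ,
    Real.volume_real_Ioo]
  rw [max_comm]
  congr 1
  grind

theorem integrable_indicator_Ioo_one (a b : ℝ) :
    Integrable ((Ioo a b).indicator (fun _ => (1:ℝ))) :=
  (integrable_indicator_iff measurableSet_Ioo).2 (integrableOn_const (by simp))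

theorem convR_eq_convolution (f g : ℝ → ℝ) :
    convR f g = convolution g f (ContinuousLinearMap.mul ℝ ℝ) volume := by
  funext x
  simp [convR, convolution, mul_comm]

theorem integrable_convR {f g : ℝ → ℝ} (hf : Integrable f) (hg : Integrable g) :
    Integrable (convR f g) := by
  rw [convR_eq_convolution]
  exact hg.integrable_convolution _ hf

theorem integral_convR {f g : ℝ → ℝ} (hf : Integrable f) (hg : Integrable g) :
    ∫ x, convR f g x = (∫ x, f x) * ∫ x, g x := by
  rw [convR_eq_convolution, integral_convolution _ hg hf, ContinuousLinearMap.mul_apply', mul_comm]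

/-- If `f` and `g` have the same integral, and either `f ≤ g` on `s` or `g ≤ f` off `s`, then
`∫ f ≤ ∫ g` over `s`. -/
theorem setIntegral_le_of_le_or_compl_le {f g : ℝ → ℝ} {s : Set ℝ} (hs : MeasurableSet s)
    (hf : Integrable f) (hg : Integrable g) (heq : ∫ x, f x = ∫ x, g x)
    (h : (∀ x ∈ s, f x ≤ g x) ∨ ∀ x ∈ sᶜ, g x ≤ f x) :
    ∫ x in s, f x ≤ ∫ x in s, g x := by
  rcases h with h | h
  · exact setIntegral_mono_on hf.integrableOn hg.integrableOn hs h
  · have := setIntegral_mono_on hg.integrableOn hf.integrableOn hs.compl h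
    have hf' := integral_add_compl hs hf
    have hg' := integral_add_compl hs hg
    linarith

theorem v_dominated_by_v0 (α : ℝ) (hα : 0 < α) (v : ℝ → ℝ) (hsd : SymmDecrR v)
    (h0 : ∀ z, 0 ≤ v z) (h1 : ∀ z, v z ≤ min (2 * α) 1)
    (hint : ∫ z, v z = 2 * α)
    (hlip : ∀ z ρ : ℝ, 0 < ρ → |v (z + ρ) - v z| ≤ ρ) :
    ∀ t₀ : ℝ, 0 < t₀ →
      ∫ z in (-t₀)..t₀, v z ≤
        ∫ z in (-t₀)..t₀,
          convR ((Set.Ioo (-α) α).indicator (fun _ => (1:ℝ))) M1 z := by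
  intro t₀ ht₀
  have hI := integrable_indicator_Ioo_one (-α) α
  have hM : Integrable M1 := integrable_indicator_Ioo_one _ _
  have hv : Integrable v := by
    by_contra hv
    rw [integral_undef hv] at hint
    linarith
  have htot : ∫ z, v z = ∫ z, convR ((Ioo (-α) α).indicator (fun _ => (1:ℝ))) M1 z := by
    rw [hint, integral_convR hI hM, M1, integral_indicator measurableSet_Ioo,
      integral_indicator measurableSet_Ioo]
    simp only [integral_const, smul_eq_mul, mul_one, measureReal_restrict_apply_univ,
      Real.volume_real_Ioo]
    rw [max_eq_left (by linarith), max_eq_left (by norm_num)]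
    ring
  have habs : ∀ x, v |x| = v x := fun x => by
    rcases abs_choice x with h | h <;> simp [h, hsd.1]
  rw [intervalIntegral.integral_of_le (by linarith), intervalIntegral.integral_of_le (by linarith)]
  refine setIntegral_le_of_le_or_compl_le measurableSet_Ioc hv (integrable_convR hI hM) htot ?_
  simp only [convR_indicator_M1]
  by_contra! hcon
  obtain ⟨⟨z, hz, hvz⟩, x, hx, hvx⟩ := hcon
  have hzt : |z| ≤ t₀ := abs_le.2 ⟨hz.1.le, hz.2⟩
  have htx : t₀ ≤ |x| := by
    by_contra! h
    exact hx ⟨(abs_lt.1 h).1, (abs_lt.1 h).2.le⟩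
  have hz1 : α + 1 / 2 - |z| < v z := by
    have := h1 z
    grind
  have hx1 : v x < α + 1 / 2 - |x| := by
    have := h0 x
    grind
  rw [← habs] at hz1 hx1
  rcases (hzt.trans htx).eq_or_lt with h | h
  · rw [h] at hz1
    linarith
  · have := (abs_le.1 (hlip |z| (|x| - |z|) (by linarith))).1
    rw [add_sub_cancel] at this
    linarith
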